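/- Let d ≥ 1, α > 0, T > 0 and δ ∈ [0,1]. There exists a constant C > 0, depending only on d, θ, α, δ and T, such that for every N ≥ 1 and every t ∈ (0,T], ∫_{ℝ^d} (1 + |y|)^{d+1} |(g_{2t} ∗ θ^N)(y)|² dy ≤ C · t^{−δd/2} · N^{αd(1−δ)}. -/

import Mathlib

open MeasureTheory Set Filter
open scoped Topology ENNReal

noncomputable section

/-- The Gaussian heat kernel `g_t` on `ℝ^d`. -/
def heatK (d : ℕ) (t : ℝ) (x : EuclideanSpace ℝ (Fin d)) : ℝ :=
  (2 * Real.pi * t) ^ (-(d : ℝ) / 2) * Real.exp (-‖x‖ ^ 2 / (2 * t))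

/-- The gradient of the Gaussian heat kernel `g_t`. -/
def heatKGrad (d : ℕ) (t : ℝ) (x : EuclideanSpace ℝ (Fin d)) : EuclideanSpace ℝ (Fin d) :=
  (-(heatK d t x) / t) • x


abbrev Eu (d : ℕ) := EuclideanSpace ℝ (Fin d)

lemma heatK_nonneg (d : ℕ) {t : ℝ} (ht : 0 < t) (x : Eu d) : 0 ≤ heatK d t x := by
  unfold heatK; positivity

lemma heatK_le (d : ℕ) {t : ℝ} (ht : 0 < t) (x : Eu d) :
    heatK d t x ≤ (2 * Real.pi * t) ^ (-(d : ℝ) / 2) := by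
  unfold heatK
  have h : Real.exp (-‖x‖ ^ 2 / (2 * t)) ≤ 1 := by
    rw [Real.exp_le_one_iff]
    apply div_nonpos_of_nonpos_of_nonneg
    · simp
    · positivity
  have h2 : 0 ≤ (2 * Real.pi * t) ^ (-(d : ℝ) / 2) := by positivity
  nlinarith

lemma heatK_cont (d : ℕ) (t : ℝ) : Continuous (heatK d t) := by
  unfold heatK
  fun_prop

lemma heatK_integral (d : ℕ) {t : ℝ} (ht : 0 < t) : ∫ x, heatK d t x = 1 := by
  unfold heatK
  rw [integral_const_mul]
  have h := GaussianFourier.integral_rexp_neg_mul_sq_norm (V := Eu d) (b := 1 / (2 * t)) (by positivity)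
  have e : ∀ x : Eu d, -‖x‖ ^ 2 / (2 * t) = -(1 / (2 * t)) * ‖x‖ ^ 2 := by intro x; ring
  simp_rw [e]
  rw [h, finrank_euclideanSpace_fin, show Real.pi / (1 / (2 * t)) = 2 * Real.pi * t by field_simp,
    ← Real.rpow_add (by positivity)]
  rw [show -(d : ℝ) / 2 + d / 2 = 0 by ring, Real.rpow_zero]

lemma heatK_integrable (d : ℕ) {t : ℝ} (ht : 0 < t) : Integrable (heatK d t) := by
  apply Integrable.of_integral_ne_zero
  rw [heatK_integral d ht]; exact one_ne_zero

lemma weight_heatK (d : ℕ) {t T : ℝ} (ht : 0 < t) (htT : t ≤ T) (n : ℕ) (x : Eu d) :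
    (1 + ‖x‖) ^ n * heatK d (2 * t) x ≤
      (n.factorial * Real.exp (1 + 2 * T) * 2 ^ ((d : ℝ) / 2)) * heatK d (4 * t) x := by
  have hT : 0 < T := ht.trans_le htT
  have h1 := Real.pow_div_factorial_le_exp (1 + ‖x‖) (by positivity) n
  rw [div_le_iff₀ (by positivity)] at h1
  have h2 : 1 + ‖x‖ ≤ (1 + 2 * T) + ‖x‖ ^ 2 / (8 * t) := by
    have a : ‖x‖ ^ 2 / (8 * T) ≤ ‖x‖ ^ 2 / (8 * t) := by gcongr
    have b : ‖x‖ ^ 2 / (8 * T) - ‖x‖ + 2 * T = (‖x‖ - 4 * T) ^ 2 / (8 * T) := by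
      field_simp; ring
    have c : 0 ≤ (‖x‖ - 4 * T) ^ 2 / (8 * T) := by positivity
    linarith
  have h3 : (1 + ‖x‖) ^ n ≤
      n.factorial * Real.exp (1 + 2 * T) * Real.exp (‖x‖ ^ 2 / (8 * t)) := by
    have := Real.exp_le_exp.mpr h2
    rw [Real.exp_add (1 + 2 * T)] at this
    calc _ ≤ _ := h1
      _ ≤ (Real.exp (1 + 2 * T) * Real.exp (‖x‖ ^ 2 / (8 * t))) * n.factorial := by gcongr
      _ = _ := by ring
  have h4 : (2 * Real.pi * (2 * t)) ^ (-(d : ℝ) / 2) =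
      2 ^ ((d : ℝ) / 2) * (2 * Real.pi * (4 * t)) ^ (-(d : ℝ) / 2) := by
    rw [show 2 * Real.pi * (4 * t) = 2 * (2 * Real.pi * (2 * t)) by ring,
      Real.mul_rpow (x := 2) (y := 2 * Real.pi * (2 * t)) (by positivity) (by positivity),
      ← mul_assoc (2 ^ ((d : ℝ) / 2)),
      ← Real.rpow_add (by positivity), show (d : ℝ) / 2 + -(d : ℝ) / 2 = 0 by ring]
    simp
  have h5 : Real.exp (‖x‖ ^ 2 / (8 * t)) * Real.exp (-‖x‖ ^ 2 / (2 * (2 * t))) =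
      Real.exp (-‖x‖ ^ 2 / (2 * (4 * t))) := by
    rw [← Real.exp_add]; congr 1; field_simp; ring
  calc _ ≤ (n.factorial * Real.exp (1 + 2 * T) * Real.exp (‖x‖ ^ 2 / (8 * t))) *
        heatK d (2 * t) x :=
        mul_le_mul_of_nonneg_right h3 (heatK_nonneg d (by positivity) x)
    _ = _ := by
      unfold heatK
      rw [h4, ← h5]; ring

lemma sq_interp {u A B δ : ℝ} (hu : 0 ≤ u) (hA : u ≤ A) (hB : u ≤ B) (h0 : 0 ≤ δ) (h1 : δ ≤ 1) :
    u ≤ A ^ δ * B ^ (1 - δ) := by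
  have h : u = u ^ δ * u ^ (1 - δ) := by
    rw [← Real.rpow_add' hu (by simp)]; simp
  calc u = u ^ δ * u ^ (1 - δ) := h
    _ ≤ A ^ δ * B ^ (1 - δ) := by
      have : 0 ≤ 1 - δ := by linarith
      have : 0 ≤ A := hu.trans hA
      gcongr

/-- Abstract bound for a mollifier of mass one. -/
lemma core (d : ℕ) {t T δ B : ℝ} (ht : 0 < t) (htT : t ≤ T) (h0 : 0 ≤ δ) (h1 : δ ≤ 1)
    (φ : Eu d → ℝ) (hi : Integrable φ) (hm : ∫ x, φ x = 1)
    (hp : ∀ x, 0 ≤ φ x) (hB : ∀ x, φ x ≤ B) (hs : ∀ x, φ x ≠ 0 → ‖x‖ ≤ 1) (n : ℕ) :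
    ∫ y : Eu d, (1 + ‖y‖) ^ n * (∫ x, heatK d (2 * t) (y - x) * φ x) ^ 2 ≤
      (((2 * Real.pi * (2 * t)) ^ (-(d : ℝ) / 2)) ^ δ * B ^ (1 - δ)) *
        (2 ^ n * (n.factorial * Real.exp (1 + 2 * T) * 2 ^ ((d : ℝ) / 2))) := by
  set A := (2 * Real.pi * (2 * t)) ^ (-(d : ℝ) / 2) with hA
  set K := (n.factorial * Real.exp (1 + 2 * T) * 2 ^ ((d : ℝ) / 2)) with hK
  have hint : ∀ s : ℝ, 0 < s → ∀ y, Integrable (fun x => heatK d s (y - x) * φ x) := by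
    intro s hs y
    refine hi.bdd_mul (c := (2 * Real.pi * s) ^ (-(d : ℝ) / 2)) ?_ ?_
    · exact ((heatK_cont d s).comp (continuous_const.sub continuous_id)).aestronglyMeasurable
    · refine Eventually.of_forall fun x => ?_
      rw [Real.norm_of_nonneg (heatK_nonneg d hs _)]
      exact heatK_le d hs _
  have ht2 : 0 < 2 * t := by positivity
  have ht4 : 0 < 4 * t := by positivity
  have hu0 : ∀ y, 0 ≤ ∫ x, heatK d (2 * t) (y - x) * φ x := fun y =>
    integral_nonneg fun x => mul_nonneg (heatK_nonneg d ht2 _) (hp x)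
  have huA : ∀ y, ∫ x, heatK d (2 * t) (y - x) * φ x ≤ A := by
    intro y
    calc _ ≤ ∫ x, A * φ x := by
          refine integral_mono (hint _ ht2 y) (hi.const_mul _) fun x => ?_
          exact mul_le_mul_of_nonneg_right (heatK_le d ht2 _) (hp x)
      _ = A := by rw [integral_const_mul, hm, mul_one]
  have huB : ∀ y, ∫ x, heatK d (2 * t) (y - x) * φ x ≤ B := by
    intro y
    calc _ ≤ ∫ x, heatK d (2 * t) (y - x) * B := by
          refine integral_mono (hint _ ht2 y)
            (((heatK_integrable d ht2).comp_sub_left y).mul_const _) fun x => ?_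
          exact mul_le_mul_of_nonneg_left (hB x) (heatK_nonneg d ht2 _)
      _ = B := by
          rw [integral_mul_const, integral_sub_left_eq_self (heatK d (2 * t)) volume y,
            heatK_integral d ht2, one_mul]
  have hw : ∀ y, (1 + ‖y‖) ^ n * ∫ x, heatK d (2 * t) (y - x) * φ x ≤
      2 ^ n * K * ∫ x, heatK d (4 * t) (y - x) * φ x := by
    intro y
    rw [← integral_const_mul, ← integral_const_mul]
    refine integral_mono ((hint _ ht2 y).const_mul _) ((hint _ ht4 y).const_mul _) fun x => ?_
    by_cases hx : φ x = 0
    · simp [hx]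
    have hx1 := hs x hx
    have hyx : 1 + ‖y‖ ≤ 2 * (1 + ‖y - x‖) := by
      have : ‖y‖ ≤ ‖y - x‖ + ‖x‖ := by simpa using norm_add_le (y - x) x
      have := norm_nonneg (y - x)
      linarith
    have h2 := weight_heatK d ht htT n (y - x)
    have hg := heatK_nonneg d ht2 (y - x)
    calc (1 + ‖y‖) ^ n * (heatK d (2 * t) (y - x) * φ x)
        ≤ (2 * (1 + ‖y - x‖)) ^ n * (heatK d (2 * t) (y - x) * φ x) := by
          have := mul_nonneg hg (hp x)
          gcongr
      _ = 2 ^ n * φ x * ((1 + ‖y - x‖) ^ n * heatK d (2 * t) (y - x)) := by rw [mul_pow]; ring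
      _ ≤ 2 ^ n * φ x * (K * heatK d (4 * t) (y - x)) := by
          have := hp x
          gcongr
      _ = 2 ^ n * K * (heatK d (4 * t) (y - x) * φ x) := by ring
  have hconv : (fun y => ∫ x, heatK d (4 * t) (y - x) * φ x) =
      convolution φ (heatK d (4 * t)) (ContinuousLinearMap.mul ℝ ℝ) volume := by
    ext y
    simp only [convolution_def, ContinuousLinearMap.mul_apply', mul_comm]
  have hci : Integrable (fun y => ∫ x, heatK d (4 * t) (y - x) * φ x) := by
    rw [hconv]; exact hi.integrable_convolution _ (heatK_integrable d ht4)
  have hcm : ∫ y, (∫ x, heatK d (4 * t) (y - x) * φ x) = 1 := by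
    rw [hconv, integral_convolution _ hi (heatK_integrable d ht4), hm, heatK_integral d ht4]
    simp
  have hB0 : 0 ≤ B := (hp 0).trans (hB 0)
  calc _ ≤ ∫ y, (A ^ δ * B ^ (1 - δ)) * (2 ^ n * K) * ∫ x, heatK d (4 * t) (y - x) * φ x := by
        refine integral_mono_of_nonneg (Eventually.of_forall fun y => ?_) (hci.const_mul _)
          (Eventually.of_forall fun y => ?_)
        · simp only [Pi.zero_apply]; positivity
        · have i1 := sq_interp (hu0 y) (huA y) (huB y) h0 h1
          have i2 := hw y
          have i3 := hu0 y
          beta_reduce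
          set u := ∫ x, heatK d (2 * t) (y - x) * φ x
          calc (1 + ‖y‖) ^ n * u ^ 2 = u * ((1 + ‖y‖) ^ n * u) := by ring
            _ ≤ (A ^ δ * B ^ (1 - δ)) * (2 ^ n * K * ∫ x, heatK d (4 * t) (y - x) * φ x) :=
              mul_le_mul i1 i2 (by positivity) (i3.trans i1)
            _ = _ := by ring
    _ = _ := by rw [integral_const_mul, hcm, mul_one]

/-- **Weighted `L²` bound on `e^{tΔ}θ^N`**: for a mollifier `θ` as above and any
`δ ∈ [0,1]`, `T > 0`, there is `C > 0` (depending only on `d, θ, α, δ, T`) such that for every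
`N ≥ 1` and `t ∈ (0,T]`,
`∫ (1+|y|)^{d+1} |(g_{2t} ∗ θ^N)(y)|² dy ≤ C t^{-δd/2} N^{αd(1-δ)}`. -/
theorem weighted_L2_heat_mollifier
    (d : ℕ) (hd : 1 ≤ d) (α T δ : ℝ) (hα : 0 < α) (hT : 0 < T) (hδ0 : 0 ≤ δ) (hδ1 : δ ≤ 1)
    (θ : EuclideanSpace ℝ (Fin d) → ℝ) (hθsmooth : ContDiff ℝ (⊤ : ℕ∞) θ)
    (hθpos : ∀ x, 0 ≤ θ x)
    (hθsupp : Function.support θ ⊆ Metric.ball (0 : EuclideanSpace ℝ (Fin d)) 1)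
    (hθmass : ∫ x, θ x = 1) :
    ∃ C : ℝ, 0 < C ∧ ∀ N : ℕ, 1 ≤ N → ∀ t ∈ Ioc (0 : ℝ) T,
      ∫ y : EuclideanSpace ℝ (Fin d),
          (1 + ‖y‖) ^ (d + 1) *
            (∫ x, heatK d (2 * t) (y - x) * ((N : ℝ) ^ (α * d) * θ ((N : ℝ) ^ α • x))) ^ 2
        ≤ C * t ^ (-(δ * d) / 2) * (N : ℝ) ^ (α * d * (1 - δ)) := by
  have hθi : Integrable θ := Integrable.of_integral_ne_zero (by rw [hθmass]; exact one_ne_zero)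
  have hcs : HasCompactSupport θ :=
    HasCompactSupport.of_support_subset_isCompact (isCompact_closedBall 0 1)
      (hθsupp.trans Metric.ball_subset_closedBall)
  obtain ⟨M0, hM0⟩ := hcs.exists_bound_of_continuous hθsmooth.continuous
  set M := max M0 1 with hMdef
  have hMpos : 0 < M := lt_of_lt_of_le one_pos (le_max_right _ _)
  have hM : ∀ x, θ x ≤ M := fun x =>
    ((le_abs_self _).trans (hM0 x)).trans (le_max_left _ _)
  set n := d + 1 with hn
  refine ⟨((2 * Real.pi * 2) ^ (-(d : ℝ) / 2)) ^ δ * M ^ (1 - δ) *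
    (2 ^ n * (n.factorial * Real.exp (1 + 2 * T) * 2 ^ ((d : ℝ) / 2))), by positivity, ?_⟩
  intro N hN t ht
  have hN1 : (1 : ℝ) ≤ N := by exact_mod_cast hN
  have hN0 : (0 : ℝ) < N := by linarith
  have hS : 1 ≤ (N : ℝ) ^ α := Real.one_le_rpow hN1 hα.le
  have hS0 : 0 < (N : ℝ) ^ α := by linarith
  have hpow : (N : ℝ) ^ (α * d) = ((N : ℝ) ^ α) ^ d := by
    rw [Real.rpow_mul hN0.le, Real.rpow_natCast]
  have key := core d (B := (N : ℝ) ^ (α * d) * M) ht.1 ht.2 hδ0 hδ1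
    (fun x => (N : ℝ) ^ (α * d) * θ ((N : ℝ) ^ α • x))
    ((hθi.comp_smul hS0.ne').const_mul _)
    (by
      rw [integral_const_mul, Measure.integral_comp_smul, hθmass, finrank_euclideanSpace_fin, hpow,
        abs_of_pos (by positivity), smul_eq_mul, mul_one, mul_inv_cancel₀ (by positivity)])
    (fun x => mul_nonneg (by positivity) (hθpos _))
    (fun x => mul_le_mul_of_nonneg_left (hM _) (by positivity))
    (fun x hx => by
      have h2 : θ ((N : ℝ) ^ α • x) ≠ 0 := right_ne_zero_of_mul hx
      have h3 := hθsupp h2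
      rw [mem_ball_zero_iff, norm_smul, Real.norm_of_nonneg hS0.le] at h3
      nlinarith [norm_nonneg x]) n
  refine key.trans (le_of_eq ?_)
  have ht0 := ht.1
  have e1 : ((2 * Real.pi * (2 * t)) ^ (-(d : ℝ) / 2)) ^ δ =
      ((2 * Real.pi * 2) ^ (-(d : ℝ) / 2)) ^ δ * t ^ (-(δ * d) / 2) := by
    rw [← mul_assoc, Real.mul_rpow (by positivity) ht0.le,
      Real.mul_rpow (by positivity) (by positivity), ← Real.rpow_mul ht0.le]
    congr 2; ring
  have e2 : ((N : ℝ) ^ (α * d) * M) ^ (1 - δ) = (N : ℝ) ^ (α * d * (1 - δ)) * M ^ (1 - δ) := by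
    rw [Real.mul_rpow (by positivity) hMpos.le, ← Real.rpow_mul hN0.le]
  rw [e1, e2]; ring


end
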